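/- Assume N ≥ 2 and fix j ∈ {1, …, N} and n ∈ ℕ. Let γ := inf { ‖p‖_{L²(G_j)}/‖p‖_{L²(G)} : p a nonzero polynomial of degree at most n } (then 0 < γ < 1). Suppose q is a polynomial of degree at most M such that |q(z) − 𝟙_{closure(G_j)}(z)| ≤ γ for all z in the closure of G, where 𝟙_{closure(G_j)} is the indicator function of the closure of G_j. Then for every ζ in the closure of G_j, (∑_{k=0}^n |P_{k,j}(ζ)|²)^{1/2} ≤ (2/(1 − γ))·(∑_{k=0}^{n+M} |P_k(ζ)|²)^{1/2}. -/

import Mathlib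

open MeasureTheory Filter Polynomial Set Metric

noncomputable section

/-- A Jordan curve: the range of an injective continuous map from the unit circle into `ℂ`. -/
def IsJordanCurve (C : Set ℂ) : Prop :=
  ∃ f : ℂ → ℂ, ContinuousOn f (sphere (0:ℂ) 1) ∧ InjOn f (sphere (0:ℂ) 1) ∧
    C = f '' sphere (0:ℂ) 1

/-- A Jordan domain: the bounded connected component of the complement of a Jordan curve. -/
def IsJordanDomain (D : Set ℂ) : Prop :=
  ∃ C : Set ℂ, IsJordanCurve C ∧ Bornology.IsBounded D ∧
    ∃ z ∈ Cᶜ, D = connectedComponentIn Cᶜ z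

/-- An archipelago: a finite family of Jordan domains with mutually disjoint closures. -/
def IsArchipelago {N : ℕ} (Gs : Fin N → Set ℂ) : Prop :=
  (∀ j, IsJordanDomain (Gs j)) ∧
  ∀ j k, j ≠ k → Disjoint (closure (Gs j)) (closure (Gs k))

/-- `P n` is the Bergman orthonormal polynomial of degree `n` for `G`, with positive real
leading coefficient `lam n`, and the family is orthonormal in `L²(G, dA)`. -/
def IsBergmanSystem (G : Set ℂ) (P : ℕ → Polynomial ℂ) (lam : ℕ → ℝ) : Prop :=
  (∀ n, (P n).natDegree = n) ∧
  (∀ n, 0 < lam n ∧ (P n).leadingCoeff = (lam n : ℂ)) ∧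
  ∀ n k, (∫ z in G, (P n).eval z * (starRingEnd ℂ) ((P k).eval z)) =
    if n = k then 1 else 0

/-- The `L²(E, dA)` norm of a polynomial. -/
def polyL2Norm (E : Set ℂ) (p : Polynomial ℂ) : ℝ :=
  Real.sqrt (∫ z in E, ‖p.eval z‖ ^ 2)

theorem IsJordanCurve.isCompact {C : Set ℂ} (hC : IsJordanCurve C) : IsCompact C := by
  obtain ⟨f, hf, -, rfl⟩ := hC
  exact (isCompact_sphere (0:ℂ) 1).image_of_continuousOn hf

theorem IsJordanDomain.isOpen {D : Set ℂ} (hD : IsJordanDomain D) : IsOpen D := by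
  obtain ⟨C, hC, -, z, -, rfl⟩ := hD
  exact hC.isCompact.isClosed.isOpen_compl.connectedComponentIn

theorem IsJordanDomain.nonempty {D : Set ℂ} (hD : IsJordanDomain D) : D.Nonempty := by
  obtain ⟨C, -, -, z, hz, rfl⟩ := hD
  exact ⟨z, mem_connectedComponentIn hz⟩

theorem IsJordanDomain.isBounded {D : Set ℂ} (hD : IsJordanDomain D) :
    Bornology.IsBounded D := by
  obtain ⟨C, -, h, -⟩ := hD
  exact h

theorem Continuous.integrableOn_of_isBounded {F : Type*} [NormedAddCommGroup F] {f : ℂ → F}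
    (hf : Continuous f) {E : Set ℂ} (hE : Bornology.IsBounded E) : IntegrableOn f E :=
  (hf.continuousOn.integrableOn_compact hE.isCompact_closure).mono_set subset_closure

theorem integrableOn_norm_eval_sq {E : Set ℂ} (hE : Bornology.IsBounded E) (p : ℂ[X]) :
    IntegrableOn (fun z => ‖p.eval z‖ ^ 2) E :=
  (p.continuous.norm.pow 2).integrableOn_of_isBounded hE

theorem setIntegral_norm_eval_sq_nonneg (E : Set ℂ) (p : ℂ[X]) :
    0 ≤ ∫ z in E, ‖p.eval z‖ ^ 2 :=
  integral_nonneg fun _ => by positivity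

theorem setIntegral_norm_eval_sq_mono {E F : Set ℂ} (hF : Bornology.IsBounded F) (hEF : E ⊆ F)
    (p : ℂ[X]) : ∫ z in E, ‖p.eval z‖ ^ 2 ≤ ∫ z in F, ‖p.eval z‖ ^ 2 :=
  setIntegral_mono_set (integrableOn_norm_eval_sq hF p)
    (Eventually.of_forall fun _ => by positivity) hEF.eventuallyLE

theorem norm_sum_mul_sq_le {ι : Type*} (s : Finset ι) (a b : ι → ℂ) :
    ‖∑ k ∈ s, a k * b k‖ ^ 2 ≤ (∑ k ∈ s, ‖a k‖ ^ 2) * ∑ k ∈ s, ‖b k‖ ^ 2 := by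
  calc ‖∑ k ∈ s, a k * b k‖ ^ 2 ≤ (∑ k ∈ s, ‖a k‖ * ‖b k‖) ^ 2 := by
        gcongr
        exact (norm_sum_le _ _).trans_eq (Finset.sum_congr rfl fun k _ => norm_mul _ _)
    _ ≤ _ := Finset.sum_mul_sq_le_sq_mul_sq _ _ _

/-- A sequence of polynomials of exact degrees `0, 1, 2, …` spans the polynomials. -/
theorem exists_eq_sum_of_natDegree_le {P : ℕ → ℂ[X]} (hdeg : ∀ n, (P n).natDegree = n)
    (hne : ∀ n, P n ≠ 0) (m : ℕ) (p : ℂ[X]) (hp : p.natDegree ≤ m) :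
    ∃ a : ℕ → ℂ, p = ∑ k ∈ Finset.range (m + 1), C (a k) * P k := by
  have key : ∀ (m : ℕ) (p : ℂ[X]), p.degree < m →
      ∃ a : ℕ → ℂ, p = ∑ k ∈ Finset.range m, C (a k) * P k := by
    intro m
    induction m with
    | zero =>
      intro p hp
      refine ⟨0, ?_⟩
      simpa [degree_lt_iff_coeff_zero, Polynomial.ext_iff] using hp
    | succ m ih =>
      intro p hp
      have hlc : (P m).coeff m ≠ 0 := by
        have := leadingCoeff_ne_zero.mpr (hne m)
        rwa [leadingCoeff, hdeg] at this
      obtain ⟨a, ha⟩ := ih (p - C (p.coeff m / (P m).coeff m) * P m) (by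
        rw [degree_lt_iff_coeff_zero] at hp ⊢
        intro k hk
        rcases hk.eq_or_lt with rfl | hk
        · simp [hlc]
        · have h1 : (P m).coeff k = 0 := coeff_eq_zero_of_natDegree_lt (by rwa [hdeg])
          simp [h1, hp k hk])
      refine ⟨Function.update a m (p.coeff m / (P m).coeff m), ?_⟩
      rw [Finset.sum_range_succ, Function.update_self, ← sub_eq_iff_eq_add, ha]
      refine Finset.sum_congr rfl fun k hk => ?_
      rw [Function.update_of_ne (Finset.mem_range.mp hk).ne]
  refine key (m + 1) p ?_
  exact_mod_cast degree_lt_iff_coeff_zero p (m + 1) |>.mpr fun k hk =>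
    coeff_eq_zero_of_natDegree_lt (by lia)

namespace IsBergmanSystem

variable {E : Set ℂ} {P : ℕ → ℂ[X]} {lam : ℕ → ℝ}

theorem ne_zero (hP : IsBergmanSystem E P lam) (n : ℕ) : P n ≠ 0 := by
  intro h
  have h1 := hP.2.1 n
  rw [h] at h1
  have h2 : lam n = 0 := by simpa using h1.2.symm
  exact h1.1.ne' h2

/-- Parseval's identity for finite combinations of Bergman polynomials. -/
theorem setIntegral_norm_sum_sq (hP : IsBergmanSystem E P lam) (hE : Bornology.IsBounded E)
    (s : Finset ℕ) (a : ℕ → ℂ) :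
    ∫ z in E, ‖(∑ k ∈ s, C (a k) * P k).eval z‖ ^ 2 = ∑ k ∈ s, ‖a k‖ ^ 2 := by
  have hint : ∀ i k, IntegrableOn
      (fun z => a i * (starRingEnd ℂ) (a k) *
        ((P i).eval z * (starRingEnd ℂ) ((P k).eval z))) E := fun i k =>
    (continuous_const.mul ((P i).continuous.mul
      (Complex.continuous_conj.comp (P k).continuous))).integrableOn_of_isBounded hE
  have h : ((∫ z in E, ‖(∑ k ∈ s, C (a k) * P k).eval z‖ ^ 2 : ℝ) : ℂ)
      = ((∑ k ∈ s, ‖a k‖ ^ 2 : ℝ) : ℂ) := by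
    rw [← integral_complex_ofReal]
    calc ∫ z in E, ((‖(∑ k ∈ s, C (a k) * P k).eval z‖ ^ 2 : ℝ) : ℂ)
        = ∫ z in E, ∑ i ∈ s, ∑ k ∈ s, a i * (starRingEnd ℂ) (a k) *
            ((P i).eval z * (starRingEnd ℂ) ((P k).eval z)) := by
          congr 1 with z
          push_cast
          rw [← Complex.mul_conj']
          simp only [eval_finsetSum, eval_mul, eval_C, map_sum, map_mul, Finset.sum_mul_sum]
          refine Finset.sum_congr rfl fun i _ => Finset.sum_congr rfl fun k _ => ?_
          ring
      _ = ∑ i ∈ s, ∑ k ∈ s, a i * (starRingEnd ℂ) (a k) * (if i = k then 1 else 0) := by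
          rw [integral_finsetSum _ fun i _ => integrable_finsetSum _ fun k _ => hint i k]
          refine Finset.sum_congr rfl fun i _ => ?_
          rw [integral_finsetSum _ fun k _ => hint i k]
          refine Finset.sum_congr rfl fun k _ => ?_
          rw [integral_const_mul, hP.2.2]
      _ = _ := by
          push_cast
          refine Finset.sum_congr rfl fun i hi => ?_
          simp [hi, Complex.mul_conj']
  exact_mod_cast h

/-- The extremal property of the Christoffel–Darboux kernel. -/
theorem norm_eval_sq_le (hP : IsBergmanSystem E P lam) (hE : Bornology.IsBounded E)
    {m : ℕ} {p : ℂ[X]} (hp : p.natDegree ≤ m) (ζ : ℂ) :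
    ‖p.eval ζ‖ ^ 2 ≤ (∫ z in E, ‖p.eval z‖ ^ 2) *
      ∑ k ∈ Finset.range (m + 1), ‖(P k).eval ζ‖ ^ 2 := by
  obtain ⟨a, rfl⟩ := exists_eq_sum_of_natDegree_le hP.1 hP.ne_zero m p hp
  rw [hP.setIntegral_norm_sum_sq hE]
  simp only [eval_finsetSum, eval_mul, eval_C]
  exact norm_sum_mul_sq_le _ _ _

theorem setIntegral_norm_eval_sq_pos (hP : IsBergmanSystem E P lam)
    (hE : Bornology.IsBounded E) {p : ℂ[X]} (hp : p ≠ 0) :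
    0 < ∫ z in E, ‖p.eval z‖ ^ 2 := by
  refine (setIntegral_norm_eval_sq_nonneg E p).lt_of_ne' fun h => hp ?_
  refine Polynomial.funext fun ζ => ?_
  have := hP.norm_eval_sq_le hE le_rfl (p := p) ζ
  rw [h, zero_mul] at this
  simpa using (sq_nonneg ‖p.eval ζ‖).antisymm' this

/-- On polynomials of degree at most `n`, the `L²` norm over any bounded set is controlled by
the `L²` norm over `E`. -/
theorem exists_setIntegral_norm_eval_sq_le (hP : IsBergmanSystem E P lam)
    (hE : Bornology.IsBounded E) {F : Set ℂ} (hF : Bornology.IsBounded F) (n : ℕ) :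
    ∃ c : ℝ, 0 < c ∧ ∀ p : ℂ[X], p.natDegree ≤ n →
      ∫ z in F, ‖p.eval z‖ ^ 2 ≤ c * ∫ z in E, ‖p.eval z‖ ^ 2 := by
  set K : ℂ → ℝ := fun z => ∑ k ∈ Finset.range (n + 1), ‖(P k).eval z‖ ^ 2
  have hKc : Continuous K := continuous_finsetSum _ fun k _ => (P k).continuous.norm.pow 2
  have hK0 : 0 ≤ ∫ z in F, K z :=
    integral_nonneg fun z => Finset.sum_nonneg fun k _ => by positivity
  refine ⟨(∫ z in F, K z) + 1, by positivity, fun p hp => ?_⟩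
  have h0 := setIntegral_norm_eval_sq_nonneg E p
  calc ∫ z in F, ‖p.eval z‖ ^ 2
      ≤ ∫ z in F, (∫ w in E, ‖p.eval w‖ ^ 2) * K z :=
        integral_mono (integrableOn_norm_eval_sq hF p)
          ((hKc.integrableOn_of_isBounded hF).const_mul _)
          fun z => hP.norm_eval_sq_le hE hp z
    _ = (∫ z in F, K z) * ∫ w in E, ‖p.eval w‖ ^ 2 := by rw [integral_const_mul, mul_comm]
    _ ≤ _ := by nlinarith

/-- The Christoffel–Darboux kernel `p` at `ζ` satisfies `p(ζ) = ‖p‖² = ∑ |P_k(ζ)|²`. -/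
theorem exists_kernel (hP : IsBergmanSystem E P lam) (hE : Bornology.IsBounded E) (n : ℕ)
    (ζ : ℂ) : ∃ p : ℂ[X], p.natDegree ≤ n ∧
      ‖p.eval ζ‖ = ∑ k ∈ Finset.range (n + 1), ‖(P k).eval ζ‖ ^ 2 ∧
      ∫ z in E, ‖p.eval z‖ ^ 2 = ∑ k ∈ Finset.range (n + 1), ‖(P k).eval ζ‖ ^ 2 := by
  refine ⟨∑ k ∈ Finset.range (n + 1), C ((starRingEnd ℂ) ((P k).eval ζ)) * P k, ?_, ?_, ?_⟩
  · refine natDegree_sum_le_of_forall_le _ _ fun k hk => (natDegree_C_mul_le _ _).trans ?_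
    rw [hP.1]
    exact Nat.lt_succ_iff.mp (Finset.mem_range.mp hk)
  · simp only [eval_finsetSum, eval_mul, eval_C, Complex.conj_mul']
    rw [← Complex.norm_of_nonneg
      (Finset.sum_nonneg fun k _ => sq_nonneg ‖(P k).eval ζ‖)]
    push_cast
    rfl
  · rw [hP.setIntegral_norm_sum_sq hE]
    simp

end IsBergmanSystem

/-- The `L²` norm of `p q` when `q` is within `γ` of `1` on `A` and of `0` on `G \ A`. -/
theorem setIntegral_norm_eval_mul_sq_le {A G : Set ℂ} (hA : MeasurableSet A)
    (hGm : MeasurableSet G) (hG : Bornology.IsBounded G) (hAG : A ⊆ G) {γ : ℝ}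
    (hγ1 : γ ≤ 1) {p q : ℂ[X]} (h1 : ∀ z ∈ A, ‖q.eval z - 1‖ ≤ γ)
    (h0 : ∀ z ∈ G \ A, ‖q.eval z‖ ≤ γ)
    (hp : γ ^ 2 * ∫ z in G, ‖p.eval z‖ ^ 2 ≤ ∫ z in A, ‖p.eval z‖ ^ 2) :
    ∫ z in G, ‖(p * q).eval z‖ ^ 2 ≤ 4 * ∫ z in A, ‖p.eval z‖ ^ 2 := by
  have bound : ∀ (S : Set ℂ) (c : ℝ), MeasurableSet S → S ⊆ G → (∀ z ∈ S, ‖q.eval z‖ ≤ c) →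
      ∫ z in S, ‖(p * q).eval z‖ ^ 2 ≤ c ^ 2 * ∫ z in S, ‖p.eval z‖ ^ 2 := by
    intro S c hS hSG hc
    rw [← integral_const_mul]
    refine setIntegral_mono_on (integrableOn_norm_eval_sq (hG.subset hSG) _)
      ((integrableOn_norm_eval_sq (hG.subset hSG) _).const_mul _) hS fun z hz => ?_
    rw [eval_mul, norm_mul, mul_pow, mul_comm]
    gcongr
    exact hc z hz
  have hbA := bound A (1 + γ) hA hAG fun z hz => by
    calc ‖q.eval z‖ = ‖1 + (q.eval z - 1)‖ := by ring_nf
      _ ≤ ‖(1:ℂ)‖ + ‖q.eval z - 1‖ := norm_add_le _ _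
      _ ≤ 1 + γ := by simpa using h1 z hz
  have hbR := bound (G \ A) γ (hGm.diff hA) sdiff_subset h0
  rw [setIntegral_sdiff hA (integrableOn_norm_eval_sq hG _) hAG,
    setIntegral_sdiff hA (integrableOn_norm_eval_sq hG _) hAG] at hbR
  have hA0 := setIntegral_norm_eval_sq_nonneg A p
  nlinarith [mul_le_mul_of_nonneg_right hγ1 hA0]

theorem polyL2Norm_nonneg (E : Set ℂ) (p : ℂ[X]) : 0 ≤ polyL2Norm E p := Real.sqrt_nonneg _

theorem polyL2Norm_sq (E : Set ℂ) (p : ℂ[X]) :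
    polyL2Norm E p ^ 2 = ∫ z in E, ‖p.eval z‖ ^ 2 :=
  Real.sq_sqrt (setIntegral_norm_eval_sq_nonneg E p)

theorem polyL2Norm_one_lt {A B G : Set ℂ} (hG : Bornology.IsBounded G) (hAG : A ⊆ G)
    (hBG : B ⊆ G) (hB : IsOpen B) (hBne : B.Nonempty)
    (hAB : Disjoint A B) : polyL2Norm A 1 < polyL2Norm G 1 := by
  refine Real.sqrt_lt_sqrt (setIntegral_norm_eval_sq_nonneg A 1) ?_
  have hBpos : 0 < ∫ z in B, ‖(1 : ℂ[X]).eval z‖ ^ 2 := by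
    have : volume B ≠ 0 := (hB.measure_pos volume hBne).ne'
    simpa [Measure.real] using ENNReal.toReal_pos this (hG.subset hBG).measure_lt_top.ne
  calc _ < (∫ z in A, ‖(1 : ℂ[X]).eval z‖ ^ 2) + ∫ z in B, ‖(1 : ℂ[X]).eval z‖ ^ 2 :=
        lt_add_of_pos_right _ hBpos
    _ = ∫ z in A ∪ B, ‖(1 : ℂ[X]).eval z‖ ^ 2 :=
        (setIntegral_union hAB hB.measurableSet (integrableOn_norm_eval_sq (hG.subset hAG) _)
          (integrableOn_norm_eval_sq (hG.subset hBG) _)).symm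
    _ ≤ _ := setIntegral_norm_eval_sq_mono hG (union_subset hAG hBG) 1

/-- With `γ` the infimum of `‖p‖_{L²(G_j)}/‖p‖_{L²(G)}` over nonzero polynomials of degree
at most `n`, one has `0 < γ < 1`; and if `q` is a polynomial of degree at most `M` with
`|q − 𝟙_{closure G_j}| ≤ γ` on the closure of `G`, then for every `ζ` in the closure of `G_j`,
`√(∑_{k≤n} |P_{k,j}(ζ)|²) ≤ (2/(1−γ))·√(∑_{k≤n+M} |P_k(ζ)|²)`. -/
theorem stmt3 (N : ℕ) (hN : 2 ≤ N) (Gs : Fin N → Set ℂ) (hArch : IsArchipelago Gs)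
    (P : ℕ → Polynomial ℂ) (lam : ℕ → ℝ)
    (hP : IsBergmanSystem (⋃ j, Gs j) P lam)
    (j : Fin N) (Pj : ℕ → Polynomial ℂ) (lamj : ℕ → ℝ)
    (hPj : IsBergmanSystem (Gs j) Pj lamj)
    (n : ℕ) (γ : ℝ)
    (hγ : γ = sInf {x : ℝ | ∃ p : Polynomial ℂ, p ≠ 0 ∧ p.natDegree ≤ n ∧
      x = polyL2Norm (Gs j) p / polyL2Norm (⋃ i, Gs i) p}) :
    (0 < γ ∧ γ < 1) ∧
    ∀ (M : ℕ) (q : Polynomial ℂ), q.natDegree ≤ M →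
      (∀ z ∈ closure (⋃ i, Gs i),
        ‖q.eval z - Set.indicator (closure (Gs j)) (fun _ => (1:ℂ)) z‖ ≤ γ) →
      ∀ ζ ∈ closure (Gs j),
        Real.sqrt (∑ k ∈ Finset.range (n + 1), ‖(Pj k).eval ζ‖ ^ 2) ≤
          2 / (1 - γ) *
            Real.sqrt (∑ k ∈ Finset.range (n + M + 1), ‖(P k).eval ζ‖ ^ 2) := by
  set G : Set ℂ := ⋃ i, Gs i
  set S : Set ℝ := {x : ℝ | ∃ p : Polynomial ℂ, p ≠ 0 ∧ p.natDegree ≤ n ∧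
      x = polyL2Norm (Gs j) p / polyL2Norm G p}
  have hGb : Bornology.IsBounded G :=
    Bornology.isBounded_iUnion.mpr fun i => (hArch.1 i).isBounded
  have hGm : MeasurableSet G := (isOpen_iUnion fun i => (hArch.1 i).isOpen).measurableSet
  have hjb := (hArch.1 j).isBounded
  have hjm := (hArch.1 j).isOpen.measurableSet
  have hjG : Gs j ⊆ G := subset_iUnion Gs j
  have hGpos : ∀ p : ℂ[X], p ≠ 0 → 0 < polyL2Norm G p := fun p hp =>
    Real.sqrt_pos.mpr (hP.setIntegral_norm_eval_sq_pos hGb hp)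
  have hSbdd : BddBelow S := by
    refine ⟨0, ?_⟩
    rintro x ⟨p, -, -, rfl⟩
    exact div_nonneg (polyL2Norm_nonneg _ _) (polyL2Norm_nonneg _ _)
  have hone : polyL2Norm (Gs j) 1 / polyL2Norm G 1 ∈ S := ⟨1, one_ne_zero, by simp, rfl⟩
  have hγ0 : 0 < γ := by
    obtain ⟨c, hc, hle⟩ := hPj.exists_setIntegral_norm_eval_sq_le hjb hGb n
    have hsc : 0 < Real.sqrt c := Real.sqrt_pos.mpr hc
    refine (inv_pos.mpr hsc).trans_le (hγ ▸ le_csInf ⟨_, hone⟩ ?_)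
    rintro x ⟨p, hp, hpn, rfl⟩
    rw [le_div_iff₀ (hGpos p hp), inv_mul_le_iff₀ hsc, polyL2Norm, polyL2Norm,
      ← Real.sqrt_mul hc.le]
    exact Real.sqrt_le_sqrt (hle p hpn)
  have hγ1 : γ < 1 := by
    have : Nontrivial (Fin N) := Fin.nontrivial_iff_two_le.mpr hN
    obtain ⟨i, hi⟩ := exists_ne j
    refine (hγ ▸ csInf_le hSbdd hone).trans_lt ((div_lt_one (hGpos 1 one_ne_zero)).mpr ?_)
    exact polyL2Norm_one_lt hGb hjG (subset_iUnion Gs i) (hArch.1 i).isOpen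
      (hArch.1 i).nonempty ((hArch.2 j i hi.symm).mono subset_closure subset_closure)
  refine ⟨⟨hγ0, hγ1⟩, fun M q hq hqγ ζ hζ => ?_⟩
  have hratio : ∀ p : ℂ[X], p.natDegree ≤ n →
      γ ^ 2 * ∫ z in G, ‖p.eval z‖ ^ 2 ≤ ∫ z in Gs j, ‖p.eval z‖ ^ 2 := by
    intro p hpn
    rcases eq_or_ne p 0 with rfl | hp
    · simp
    · have h : γ ≤ polyL2Norm (Gs j) p / polyL2Norm G p :=
        hγ ▸ csInf_le hSbdd ⟨p, hp, hpn, rfl⟩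
      rw [le_div_iff₀ (hGpos p hp)] at h
      rw [← polyL2Norm_sq, ← polyL2Norm_sq, ← mul_pow]
      exact pow_le_pow_left₀ (mul_nonneg hγ0.le (polyL2Norm_nonneg _ _)) h 2
  have hq1 : ∀ z ∈ closure (Gs j), ‖q.eval z - 1‖ ≤ γ := fun z hz => by
    simpa [hz] using hqγ z (closure_mono hjG hz)
  have hq0 : ∀ z ∈ G \ Gs j, ‖q.eval z‖ ≤ γ := by
    rintro z ⟨hzG, hzj⟩
    obtain ⟨i, hi⟩ := mem_iUnion.mp hzG
    have hij : i ≠ j := by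
      rintro rfl
      exact hzj hi
    have hz : z ∉ closure (Gs j) :=
      disjoint_left.mp (hArch.2 i j hij) (subset_closure hi)
    simpa [hz] using hqγ z (subset_closure hzG)
  obtain ⟨p, hpn, hpζ, hpint⟩ := hPj.exists_kernel hjb n ζ
  have hpq := setIntegral_norm_eval_mul_sq_le hjm hGm hGb hjG hγ1.le
    (fun z hz => hq1 z (subset_closure hz)) hq0 (hratio p hpn)
  have hkey := hP.norm_eval_sq_le hGb
    (natDegree_mul_le.trans (Nat.add_le_add hpn hq) : (p * q).natDegree ≤ n + M) ζ
  rw [eval_mul, norm_mul, hpζ] at hkey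
  rw [hpint] at hpq
  set s := ∑ k ∈ Finset.range (n + 1), ‖(Pj k).eval ζ‖ ^ 2
  set t := ∑ k ∈ Finset.range (n + M + 1), ‖(P k).eval ζ‖ ^ 2
  have hs0 : 0 ≤ s := Finset.sum_nonneg fun k _ => sq_nonneg _
  have ht0 : 0 ≤ t := Finset.sum_nonneg fun k _ => sq_nonneg _
  have hqζ : 1 - γ ≤ ‖q.eval ζ‖ := by
    have h := norm_sub_norm_le (1:ℂ) (q.eval ζ)
    rw [norm_one, norm_sub_rev] at h
    linarith [hq1 ζ hζ]
  have hst : (s * (1 - γ)) ^ 2 ≤ 4 * s * t := by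
    have h1γ : 0 ≤ 1 - γ := by linarith
    calc (s * (1 - γ)) ^ 2 ≤ (s * ‖q.eval ζ‖) ^ 2 := by gcongr
      _ ≤ _ := hkey.trans (by gcongr)
  have h1γ : 0 < 1 - γ := by linarith
  rw [div_mul_eq_mul_div, le_div_iff₀ h1γ]
  refine le_of_sq_le_sq ?_ (by positivity)
  rw [mul_pow, mul_pow, Real.sq_sqrt hs0, Real.sq_sqrt ht0]
  rcases hs0.eq_or_lt with hs | hs
  · rw [← hs]
    linarith
  · refine le_of_mul_le_mul_left ?_ hs
    linarith
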